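/- Suppose ρ₁ = ρ₂ = ρ and ρ⁻¹ = (t/s)^{1/r} for some positive integers s, t, r with gcd(s, t) = 1 and t ∉ pℤ. If c = κ·ρ⁻¹ for some κ ∈ ℚ and s ∉ pℤ, then every orthogonal set of exponentials for μ_{M,D} contains at most p elements, and this bound is attained: there exists an orthogonal set of exponentials for μ_{M,D} with exactly p elements. -/

import Mathlib

open MeasureTheory Complex Matrix
open scoped ENNReal

noncomputable section

/-- The exponential function `e_λ(x) = e^{-2πi⟨λ,x⟩}` on `ℝ²`. -/
def expChar (lam x : Fin 2 → ℝ) : ℂ :=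
  Complex.exp ((-2 * Real.pi * Complex.I) * ((lam 0 * x 0 + lam 1 * x 1 : ℝ) : ℂ))

/-- The Fourier transform `μ̂(ξ) = ∫ e^{-2πi⟨ξ,x⟩} dμ(x)` of a measure on `ℝ²`. -/
def ftMeasure (μ : Measure (Fin 2 → ℝ)) (ξ : Fin 2 → ℝ) : ℂ :=
  ∫ x, expChar ξ x ∂μ

/-- The mask `m_D(ξ) = (1/p) Σ_{d∈D} e^{-2πi⟨ξ,d⟩}` of a digit system `D : Fin p → ℝ²`. -/
def mask {p : ℕ} (D : Fin p → (Fin 2 → ℝ)) (ξ : Fin 2 → ℝ) : ℂ :=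
  (p : ℂ)⁻¹ * ∑ i : Fin p, expChar ξ (D i)

/-- Integer digits, coerced to real vectors. -/
def digitR {p : ℕ} (D : Fin p → (Fin 2 → ℤ)) : Fin p → (Fin 2 → ℝ) :=
  fun i j => (D i j : ℝ)

/-- `μ` is the self-affine measure of the IFS `φ_d(x) = M⁻¹(x+d)`, `d ∈ D`:
a compactly supported Borel probability measure with `μ = (1/#D) Σ_d μ ∘ φ_d⁻¹`. -/
def IsSelfAffine {p : ℕ} (μ : Measure (Fin 2 → ℝ)) (M : Matrix (Fin 2) (Fin 2) ℝ)
    (D : Fin p → (Fin 2 → ℝ)) : Prop :=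
  IsProbabilityMeasure μ ∧ (∃ K : Set (Fin 2 → ℝ), IsCompact K ∧ μ Kᶜ = 0) ∧
  μ = (p : ℝ≥0∞)⁻¹ • ∑ i : Fin p, μ.map (fun x => M⁻¹.mulVec (x + D i))

/-- `Λ` is an orthogonal set of exponentials for `μ`. -/
def IsOrthoSet (μ : Measure (Fin 2 → ℝ)) (Λ : Set (Fin 2 → ℝ)) : Prop :=
  ∀ l ∈ Λ, ∀ l' ∈ Λ, l ≠ l' → ftMeasure μ (l - l') = 0

/-- `μ` is a spectral measure: some countable set of exponentials forms an
orthonormal (Hilbert) basis of `L²(μ)`. -/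
def IsSpectral (μ : Measure (Fin 2 → ℝ)) : Prop :=
  ∃ Λ : Set (Fin 2 → ℝ), Λ.Countable ∧
    ∃ b : HilbertBasis Λ ℂ (Lp ℂ 2 μ),
      ∀ lam : Λ, ⇑(b lam) =ᵐ[μ] expChar (lam : Fin 2 → ℝ)

/-- The standing assumption on the digit set: `a = (a₁,a₂)` has entries in `[1,p-1]`
and `Z(m_D) = ⋃_{j=1}^{p-1} (j·a/p + ℤ²)`. -/
def ZeroSetCond (p : ℕ) (D : Fin p → (Fin 2 → ℤ)) (a : Fin 2 → ℤ) : Prop :=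
  (∀ i, 1 ≤ a i ∧ a i ≤ (p : ℤ) - 1) ∧
  ∀ ξ : Fin 2 → ℝ, mask (digitR D) ξ = 0 ↔
    ∃ j : ℕ, 1 ≤ j ∧ j ≤ p - 1 ∧ ∃ k : Fin 2 → ℤ,
      ∀ i, ξ i = (j : ℝ) * (a i : ℝ) / p + (k i : ℝ)

/-- The upper-triangular expanding matrix `M = [[ρ₁⁻¹, c],[0, ρ₂⁻¹]]`. -/
def Mupper (ρ₁ ρ₂ c : ℝ) : Matrix (Fin 2) (Fin 2) ℝ := !![ρ₁⁻¹, c; 0, ρ₂⁻¹]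

/-- The set `E_a = {h/l : gcd(h,l)=1, l·a₂ − h·a₁ ∈ ℤ∖pℤ} ∪ {0}`. -/
def Ea (p : ℕ) (a : Fin 2 → ℤ) : Set ℝ :=
  {x | ∃ h l : ℤ, Int.gcd h l = 1 ∧ ¬ ((p : ℤ) ∣ (l * a 1 - h * a 0)) ∧
    x = (h : ℝ) / (l : ℝ)} ∪ {0}


theorem min_deg (b : ℝ) (hb : 0 < b) (r : ℕ) (hr : 0 < r) (w : ℚ) (hw : b ^ r = (w:ℝ)) :
    ∃ q : ℚ, b ^ (minpoly ℚ b).natDegree = (q : ℝ) := by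
  have hint : IsIntegral ℚ b := by
    refine ⟨Polynomial.X ^ r - Polynomial.C w, Polynomial.monic_X_pow_sub_C w hr.ne', ?_⟩
    simp [hw]
  have hdvd : minpoly ℚ b ∣ Polynomial.X ^ r - Polynomial.C w := by
    apply minpoly.dvd
    simp [hw]
  set m := minpoly ℚ b with hm
  have hmon : m.Monic := minpoly.monic hint
  let M : Polynomial ℂ := m.map (algebraMap ℚ ℂ)
  have hMmon : M.Monic := hmon.map _
  have hsp : M.Splits := IsAlgClosed.splits M
  have hroots : ∀ z ∈ M.roots, ‖z‖ = b := by
    intro z hz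
    have hz1 : M.IsRoot z := Polynomial.isRoot_of_mem_roots hz
    have hd2 : M ∣ (Polynomial.X ^ r - Polynomial.C w : Polynomial ℚ).map (algebraMap ℚ ℂ) :=
      Polynomial.map_dvd _ hdvd
    have hz2 := hz1.dvd hd2
    simp [Polynomial.IsRoot] at hz2
    have h3 : z ^ r = ((w:ℝ) : ℂ) := by push_cast; linear_combination hz2
    have h4 : ‖z‖ ^ r = b ^ r := by
      rw [← norm_pow, h3, ← hw]
      simp [abs_of_pos hb]
    exact (pow_left_inj₀ (norm_nonneg _) hb.le hr.ne').1 h4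
  have hc := hsp.coeff_zero_eq_prod_roots_of_monic hMmon
  have hcard : M.roots.card = m.natDegree := by
    rw [← hsp.natDegree_eq_card_roots]
    exact hmon.natDegree_map _
  have hprod : ‖M.roots.prod‖ = b ^ m.natDegree := by
    rw [← hcard]
    generalize M.roots = S at hroots
    induction S using Multiset.induction_on with
    | empty => simp
    | cons a S ih =>
      simp only [Multiset.prod_cons, norm_mul, Multiset.card_cons]
      rw [ih (fun z hz => hroots z (Multiset.mem_cons_of_mem hz)), hroots a (by simp), pow_succ, mul_comm]
  refine ⟨|m.coeff 0|, ?_⟩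
  rw [← hprod]
  have : ‖M.coeff 0‖ = ‖M.roots.prod‖ := by rw [hc]; simp
  rw [← this]
  simp [M]

theorem trinom (b : ℝ) (hb : 0 < b) (r : ℕ) (hr : 0 < r) (w : ℚ) (hw : b ^ r = (w:ℝ))
    (n₁ n₂ n₃ : ℕ) (q₁ q₂ q₃ : ℚ) (h1 : q₁ ≠ 0) (h2 : q₂ ≠ 0)
    (h : b ^ n₁ * q₁ + b ^ n₂ * q₂ = b ^ n₃ * q₃) :
    ∃ q : ℚ, b ^ n₁ = b ^ n₂ * q := by
  obtain ⟨v, hv⟩ := min_deg b hb r hr w hw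
  have hint : IsIntegral ℚ b := by
    refine ⟨Polynomial.X ^ r - Polynomial.C w, Polynomial.monic_X_pow_sub_C w hr.ne', ?_⟩
    simp [hw]
  have hdpos := minpoly.natDegree_pos hint
  set d := (minpoly ℚ b).natDegree with hd
  have hv0 : v ≠ 0 := by
    rintro rfl
    have := pow_pos hb d
    rw [hv] at this; simp at this
  have red : ∀ n, b ^ n = b ^ (n % d) * (v ^ (n / d) : ℚ) := by
    intro n
    conv_lhs => rw [← Nat.mod_add_div n d, pow_add, pow_mul, hv]
    push_cast; rfl
  have hv0' : (v:ℝ) ≠ 0 := by exact_mod_cast hv0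
  by_cases he : n₁ % d = n₂ % d
  · refine ⟨v ^ (n₁ / d) / v ^ (n₂ / d), ?_⟩
    rw [red n₁, red n₂, he]
    push_cast
    field_simp
  exfalso
  let P : Polynomial ℚ := Polynomial.monomial (n₁ % d) (v ^ (n₁/d) * q₁)
    + Polynomial.monomial (n₂ % d) (v ^ (n₂/d) * q₂)
    - Polynomial.monomial (n₃ % d) (v ^ (n₃/d) * q₃)
  have hP : Polynomial.aeval b P = 0 := by
    simp only [P, map_sub, map_add, Polynomial.aeval_monomial, eq_ratCast]
    rw [red n₁, red n₂, red n₃] at h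
    push_cast at h ⊢
    linear_combination h
  have hP0 : P = 0 := by
    by_contra hne
    have h5 := minpoly.degree_le_of_ne_zero ℚ b hne hP
    have h6 : P.degree < d := by
      have hm : ∀ n (q : ℚ), (Polynomial.monomial (n % d) q).degree < (d : WithBot ℕ) := fun n q =>
        lt_of_le_of_lt (Polynomial.degree_monomial_le _ _) (by exact_mod_cast Nat.mod_lt _ hdpos)
      refine lt_of_le_of_lt (Polynomial.degree_sub_le _ _) (max_lt ?_ (hm _ _))
      exact lt_of_le_of_lt (Polynomial.degree_add_le _ _) (max_lt (hm _ _) (hm _ _))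
    rw [Polynomial.degree_eq_natDegree (minpoly.ne_zero hint)] at h5
    exact absurd (lt_of_le_of_lt h5 h6) (lt_irrefl _)
  have c1 := congrArg (fun Q => Polynomial.coeff Q (n₁ % d)) hP0
  have c2 := congrArg (fun Q => Polynomial.coeff Q (n₂ % d)) hP0
  simp only [P, Polynomial.coeff_sub, Polynomial.coeff_add, Polynomial.coeff_monomial, Polynomial.coeff_zero, if_true, if_neg he, if_neg (Ne.symm he)] at c1 c2
  by_cases h3 : n₃ % d = n₁ % d
  · rw [if_neg (by rw [h3]; exact he)] at c2
    simp [h2, hv0] at c2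
  · rw [if_neg h3] at c1
    simp [h1, hv0] at c1

theorem padic_card (p : ℕ) [hp : Fact p.Prime] {ι : Type*} (Λ : Finset ι) (f : ι → ℚ) (l₀ : ι) (h0 : l₀ ∈ Λ)
    (hf0 : f l₀ = 0)
    (hf : ∀ l ∈ Λ, ∀ l' ∈ Λ, l ≠ l' → ‖((f l - f l' : ℚ) : ℚ_[p])‖ = 1) : Λ.card ≤ p := by
  have hle : ∀ l ∈ Λ, ‖(f l : ℚ_[p])‖ ≤ 1 := by
    intro l hl
    by_cases h : l = l₀
    · simp [h, hf0]
    · have := hf l hl l₀ h0 h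
      rw [hf0, sub_zero] at this
      exact this.le
  have hex : ∀ l ∈ Λ, ∃ z : ℤ_[p], (z : ℚ_[p]) = f l := fun l hl => ⟨⟨_, hle l hl⟩, rfl⟩
  choose! z hz using hex
  have : Λ.card ≤ (Finset.univ : Finset (ZMod p)).card := by
    apply Finset.card_le_card_of_injOn (fun l => PadicInt.toZMod (z l)) (by simp)
    intro l hl l' hl' hg
    by_contra hne
    have h1 := hf l hl l' hl' hne
    simp only at hg
    rw [← sub_eq_zero, ← map_sub, ← RingHom.mem_ker, PadicInt.ker_toZMod, IsLocalRing.mem_maximalIdeal,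
      PadicInt.mem_nonunits] at hg
    rw [PadicInt.norm_def] at hg
    push_cast at h1 hg
    rw [hz l hl, hz l' hl'] at hg
    linarith
  simpa [ZMod.card] using this

theorem combi (p : ℕ) (hp : p.Prime) (b : ℝ) (hb : 0 < b) (s t r : ℕ) (hs : 0 < s) (ht : 0 < t) (hr : 0 < r)
    (hb' : b ^ r = (t : ℝ) / (s : ℝ)) (htp : ¬ p ∣ t) (hsp : ¬ p ∣ s)
    {ι : Type*} (Λ : Finset ι) (g : ι → ℝ)
    (hg : ∀ l ∈ Λ, ∀ l' ∈ Λ, l ≠ l' → ∃ n : ℕ, ∃ u : ℤ, ¬ (p:ℤ) ∣ u ∧ g l - g l' = b ^ n * u / p) :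
    Λ.card ≤ p := by
  have := Fact.mk hp
  have hw : b ^ r = ((t / s : ℚ) : ℝ) := by rw [hb']; push_cast; rfl
  have hp0 : (p:ℝ) ≠ 0 := by exact_mod_cast hp.ne_zero
  by_cases hcard : Λ.card ≤ 1
  · exact hcard.trans hp.one_le
  push Not at hcard
  obtain ⟨l₀, h0, l₁, h1, h01⟩ := Finset.one_lt_card.1 hcard
  obtain ⟨n₀, u₀, hu₀, hd₀⟩ := hg l₀ h0 l₁ h1 h01
  have hun : ∀ u : ℤ, ¬ (p:ℤ) ∣ u → (u:ℚ) ≠ 0 := by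
    intro u hu h
    apply hu
    have : u = 0 := by exact_mod_cast h
    simp [this]
  have hbn : b ^ n₀ ≠ 0 := (pow_pos hb _).ne'
  have hrat : ∀ l ∈ Λ, ∃ q : ℚ, p * (g l - g l₀) = b ^ n₀ * q := by
    intro l hl
    by_cases e0 : l = l₀
    · exact ⟨0, by simp [e0]⟩
    by_cases e1 : l = l₁
    · refine ⟨-u₀, ?_⟩
      subst e1
      push_cast
      field_simp at hd₀
      linear_combination -hd₀
    obtain ⟨n, u, hu, hd⟩ := hg l hl l₀ h0 e0
    obtain ⟨n', u', hu', hd'⟩ := hg l hl l₁ h1 e1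
    field_simp at hd hd₀ hd'
    obtain ⟨q, hq⟩ := trinom b hb r hr _ hw n n₀ n' u u₀ u' (hun _ hu) (hun _ hu₀) (by
      push_cast
      linear_combination -hd - hd₀ + hd')
    refine ⟨q * u, ?_⟩
    push_cast
    rw [← mul_assoc, ← hq, ← hd, mul_comm]
  choose! f hf using hrat
  apply padic_card p Λ f l₀ h0
  · have := hf l₀ h0
    simp [hbn] at this
    exact this
  intro l hl l' hl' hne
  obtain ⟨n, u, hu, hd⟩ := hg l hl l' hl' hne
  have e1 := hf l hl
  have e2 := hf l' hl'
  field_simp at hd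
  have hu0 : (u:ℝ) ≠ 0 := by exact_mod_cast hun u hu
  -- b^n = b^n₀ * q
  have key : b ^ n * u = b ^ n₀ * ((f l - f l' : ℚ) : ℝ) := by
    push_cast
    linear_combination e1 - e2 - hd
  obtain ⟨q, hq⟩ : ∃ q : ℚ, f l - f l' = q * u :=
    ⟨(f l - f l') / u, by rw [div_mul_cancel₀ _ (hun u hu)]⟩
  rw [hq] at key ⊢
  have hbq : b ^ n = b ^ n₀ * q := by
    push_cast at key
    rw [← mul_assoc] at key
    exact mul_right_cancel₀ hu0 key
  have hpow : (t / s : ℚ) ^ n = (t / s : ℚ) ^ n₀ * q ^ r := by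
    have : (b ^ n) ^ r = (b ^ n₀ * q) ^ r := by rw [hbq]
    rw [mul_pow, ← pow_mul, ← pow_mul, mul_comm n, mul_comm n₀, pow_mul, pow_mul, hw] at this
    exact_mod_cast this
  have nN : ∀ k : ℕ, ¬ p ∣ k → ‖(k : ℚ_[p])‖ = 1 := by
    intro k hk
    rw [Padic.norm_natCast_eq_one_iff]
    exact (hp.coprime_iff_not_dvd.2 hk)
  have nq : ‖(q : ℚ_[p])‖ = 1 := by
    have := congrArg (fun x : ℚ => ‖(x : ℚ_[p])‖) hpow
    push_cast at this
    simp only [norm_mul, norm_pow, norm_div, nN t htp, nN s hsp, div_one, one_pow, one_mul] at this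
    exact (pow_eq_one_iff_of_nonneg (norm_nonneg _) hr.ne').1 this.symm
  have nu : ‖(u : ℚ_[p])‖ = 1 := by
    rcases (Padic.norm_int_le_one (p := p) u).lt_or_eq with h | h
    · exact absurd ((Padic.norm_intCast_lt_one_iff).1 h) hu
    · exact h
  push_cast
  rw [norm_mul, nq, nu, one_mul]

def Tm (ρ c : ℝ) (ξ : Fin 2 → ℝ) : Fin 2 → ℝ := ![ρ * ξ 0, ρ * (ξ 1 - c * ρ * ξ 0)]

theorem Mupper_inv_mulVec (ρ c : ℝ) (hρ : 0 < ρ) (y : Fin 2 → ℝ) :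
    (Mupper ρ ρ c)⁻¹.mulVec y = ![ρ * y 0 - c * ρ ^ 2 * y 1, ρ * y 1] := by
  have h : (Mupper ρ ρ c)⁻¹ = !![ρ, - (c * ρ ^ 2); 0, ρ] := by
    apply Matrix.inv_eq_right_inv
    ext i j
    fin_cases i <;> fin_cases j <;> simp [Mupper, Matrix.mul_apply, Fin.sum_univ_two, hρ.ne']
    field_simp
    ring
  rw [h]
  ext i
  fin_cases i <;> simp [Matrix.mulVec, dotProduct, Fin.sum_univ_two]
  ring

theorem expChar_cont (ξ : Fin 2 → ℝ) : Continuous (expChar ξ) := by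
  unfold expChar
  fun_prop

theorem expChar_cont_left (x : Fin 2 → ℝ) : Continuous (fun ξ => expChar ξ x) := by
  unfold expChar
  fun_prop

theorem expChar_norm (ξ x : Fin 2 → ℝ) : ‖expChar ξ x‖ = 1 := by
  unfold expChar
  rw [show (-2 * Real.pi * Complex.I) * ((ξ 0 * x 0 + ξ 1 * x 1 : ℝ) : ℂ) =
    ((-2 * Real.pi * (ξ 0 * x 0 + ξ 1 * x 1) : ℝ) : ℂ) * Complex.I by push_cast; ring]
  exact Complex.norm_exp_ofReal_mul_I _

theorem expChar_integrable (μ : Measure (Fin 2 → ℝ)) [IsFiniteMeasure μ] (ξ : Fin 2 → ℝ) :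
    Integrable (expChar ξ) μ :=
  Integrable.of_bound (expChar_cont ξ).aestronglyMeasurable 1
    (Filter.Eventually.of_forall fun x => (expChar_norm ξ x).le)

theorem expChar_inv (ρ c : ℝ) (hρ : 0 < ρ) (ξ x d : Fin 2 → ℝ) :
    expChar ξ ((Mupper ρ ρ c)⁻¹.mulVec (x + d)) = expChar (Tm ρ c ξ) d * expChar (Tm ρ c ξ) x := by
  rw [Mupper_inv_mulVec ρ c hρ]
  unfold expChar Tm
  rw [← Complex.exp_add]
  congr 1
  simp
  ring

theorem ft_step {p : ℕ} (ρ c : ℝ) (hρ : 0 < ρ) (D : Fin p → (Fin 2 → ℝ))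
    (μ : Measure (Fin 2 → ℝ)) (hμ : IsSelfAffine μ (Mupper ρ ρ c) D) (ξ : Fin 2 → ℝ) :
    ftMeasure μ ξ = mask D (Tm ρ c ξ) * ftMeasure μ (Tm ρ c ξ) := by
  obtain ⟨hprob, -, heq⟩ := hμ
  have hcont : ∀ i, Continuous (fun x : Fin 2 → ℝ => (Mupper ρ ρ c)⁻¹.mulVec (x + D i)) := by
    intro i
    exact Continuous.matrix_mulVec continuous_const (by fun_prop)
  have hmap : ∀ i, ∫ x, expChar ξ x ∂(μ.map (fun x => (Mupper ρ ρ c)⁻¹.mulVec (x + D i)))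
      = expChar (Tm ρ c ξ) (D i) * ftMeasure μ (Tm ρ c ξ) := by
    intro i
    rw [integral_map (hcont i).aemeasurable (expChar_cont ξ).aestronglyMeasurable]
    simp_rw [expChar_inv ρ c hρ]
    rw [integral_const_mul]
    rfl
  conv_lhs => rw [ftMeasure, heq]
  rw [integral_smul_measure, integral_finsetSum_measure]
  · simp_rw [hmap]
    rw [← Finset.sum_mul, mask, mul_assoc]
    simp
  · intro i _
    have : IsProbabilityMeasure (μ.map (fun x => (Mupper ρ ρ c)⁻¹.mulVec (x + D i))) :=
      Measure.isProbabilityMeasure_map (hcont i).aemeasurable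
    exact expChar_integrable _ _

theorem ft_cont (μ : Measure (Fin 2 → ℝ)) [IsProbabilityMeasure μ] : Continuous (ftMeasure μ) := by
  unfold ftMeasure
  apply continuous_of_dominated (bound := fun _ => 1)
  · exact fun ξ => (expChar_cont ξ).aestronglyMeasurable
  · exact fun ξ => Filter.Eventually.of_forall fun x => (expChar_norm ξ x).le
  · exact integrable_const _
  · exact Filter.Eventually.of_forall expChar_cont_left

theorem ft_zero (μ : Measure (Fin 2 → ℝ)) [IsProbabilityMeasure μ] : ftMeasure μ 0 = 1 := by
  simp [ftMeasure, expChar]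

theorem Tm_iter (ρ c : ℝ) (n : ℕ) (ξ : Fin 2 → ℝ) :
    (Tm ρ c)^[n] ξ = ![ρ ^ n * ξ 0, ρ ^ n * ξ 1 - (n * ρ ^ n) * (c * ρ * ξ 0)] := by
  induction n with
  | zero => ext i; fin_cases i <;> simp
  | succ n ih =>
    rw [Function.iterate_succ_apply', ih]
    ext i
    fin_cases i <;> simp [Tm] <;> ring

theorem ft_zero_exists {p : ℕ} (ρ c : ℝ) (hρ : 0 < ρ) (hρ1 : ρ < 1) (D : Fin p → (Fin 2 → ℝ))
    (μ : Measure (Fin 2 → ℝ)) (hμ : IsSelfAffine μ (Mupper ρ ρ c) D) (ξ : Fin 2 → ℝ)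
    (h : ftMeasure μ ξ = 0) : ∃ n, mask D ((Tm ρ c)^[n] ξ) = 0 := by
  by_contra hcon
  push Not at hcon
  have hprob := hμ.1
  have hz : ∀ n, ftMeasure μ ((Tm ρ c)^[n] ξ) = 0 := by
    intro n
    induction n with
    | zero => exact h
    | succ n ih =>
      rw [ft_step ρ c hρ D μ hμ, ← Function.iterate_succ_apply' (Tm ρ c)] at ih
      exact (mul_eq_zero.1 ih).resolve_left (hcon _)
  have hlim : Filter.Tendsto (fun n => (Tm ρ c)^[n] ξ) Filter.atTop (nhds 0) := by
    have h1 := tendsto_pow_atTop_nhds_zero_of_lt_one hρ.le hρ1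
    have h2 := tendsto_self_mul_const_pow_of_lt_one hρ.le hρ1
    rw [tendsto_pi_nhds]
    intro i
    simp_rw [Tm_iter]
    fin_cases i
    · simpa using h1.mul_const (ξ 0)
    · simpa using (h1.mul_const (ξ 1)).sub (h2.mul_const (c * ρ * ξ 0))
  have h3 := ((ft_cont μ).tendsto 0).comp hlim
  rw [ft_zero] at h3
  have h4 : (ftMeasure μ ∘ fun n => (Tm ρ c)^[n] ξ) = fun _ => 0 := funext hz
  rw [h4] at h3
  exact zero_ne_one (tendsto_nhds_unique tendsto_const_nhds h3)

/-- Theorem 1.2(ii)(a): if `ρ⁻¹ = (t/s)^{1/r}` with `gcd(s,t)=1`, `p ∤ t`, `c = κρ⁻¹` with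
`κ ∈ ℚ` and `p ∤ s`, then there are at most `p` mutually orthogonal exponentials in
`L²(μ_{M,D})`, and `p` is attained. -/
theorem stmt2 (p : ℕ) (hp : p.Prime) (ρ c : ℝ) (hρ0 : 0 < ρ) (hρ1 : ρ < 1)
    (D : Fin p → (Fin 2 → ℤ)) (hD : Function.Injective D)
    (a : Fin 2 → ℤ) (hZ : ZeroSetCond p D a)
    (μ : Measure (Fin 2 → ℝ)) (hμ : IsSelfAffine μ (Mupper ρ ρ c) (digitR D))
    (s t r : ℕ) (hs : 0 < s) (ht : 0 < t) (hr : 0 < r)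
    (hst : Nat.gcd s t = 1) (hρr : ρ⁻¹ ^ r = (t : ℝ) / (s : ℝ))
    (htp : ¬ p ∣ t) (hc : ∃ κ : ℚ, c = (κ : ℝ) * ρ⁻¹) (hsp : ¬ p ∣ s) :
    (∀ Λ : Finset (Fin 2 → ℝ), IsOrthoSet μ ↑Λ → Λ.card ≤ p) ∧
      (∃ Λ : Finset (Fin 2 → ℝ), IsOrthoSet μ ↑Λ ∧ Λ.card = p) := by
  obtain ⟨ha, hZ⟩ := hZ
  have hp0 : (p:ℝ) ≠ 0 := by exact_mod_cast hp.ne_zero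
  have hpa : ∀ j : ℤ, ¬ (p:ℤ) ∣ j → ∀ i, ¬ (p:ℤ) ∣ j * a i := by
    intro j hj i hd
    rcases (Nat.prime_iff_prime_int.1 hp).dvd_or_dvd hd with h | h
    · exact hj h
    · have := Int.le_of_dvd (by linarith [(ha i).1]) h
      linarith [(ha i).2]
  refine ⟨?_, ?_⟩
  · intro Λ hΛ
    apply combi p hp ρ⁻¹ (inv_pos.2 hρ0) s t r hs ht hr hρr htp hsp Λ (fun l => l 0)
    intro l hl l' hl' hne
    obtain ⟨n, hn⟩ := ft_zero_exists ρ c hρ0 hρ1 _ μ hμ _ (hΛ l hl l' hl' hne)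
    rw [hZ] at hn
    obtain ⟨j, hj1, hj2, k, hk⟩ := hn
    have h0 := hk 0
    rw [Tm_iter] at h0
    simp at h0
    refine ⟨n, j * a 0 + k 0 * p, ?_, ?_⟩
    · intro hd
      rw [Int.dvd_add_left (Dvd.intro_left _ rfl)] at hd
      refine hpa j ?_ 0 hd
      intro hdj
      have := Nat.le_of_dvd hj1 (Int.natCast_dvd_natCast.1 hdj)
      have := hp.pos
      omega
    · have hρn : ρ ^ n ≠ 0 := (pow_pos hρ0 n).ne'
      rw [inv_pow]
      push_cast
      field_simp
      field_simp at h0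
      linear_combination h0
  · -- the lower bound
    let f : ℕ → (Fin 2 → ℝ) := fun j =>
      ![ρ⁻¹ * (j * a 0 / p), ρ⁻¹ * (j * a 1 / p) + c * (j * a 0 / p)]
    have ha0 : (a 0 : ℝ) ≠ 0 := by
      have := (ha 0).1
      exact_mod_cast (by omega : a 0 ≠ 0)
    have hinj : Function.Injective f := by
      intro i j hij
      have := congrFun hij 0
      simp [f, hρ0.ne', hp0, ha0] at this
      exact this
    have hT : ∀ i j, Tm ρ c (f i - f j) = fun k => ((i:ℝ) - j) * a k / p := by
      intro i j
      ext k
      fin_cases k <;> simp [Tm, f] <;> field_simp <;> ring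
    refine ⟨(Finset.range p).map ⟨f, hinj⟩, ?_, by simp⟩
    intro l hl l' hl' hne
    simp at hl hl'
    obtain ⟨i, hi, rfl⟩ := hl
    obtain ⟨j, hj, rfl⟩ := hl'
    have hij : i ≠ j := fun h => hne (by rw [h])
    rw [ft_step ρ c hρ0 _ μ hμ, hT]
    have hm : mask (digitR D) (fun k => ((i:ℝ) - j) * a k / p) = 0 := by
      rw [hZ]
      rcases lt_or_gt_of_ne hij with h | h
      · refine ⟨p - j + i, by omega, by omega, fun k => - a k, fun k => ?_⟩
        push_cast [Nat.cast_sub hj.le]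
        field_simp
        ring
      · refine ⟨i - j, by omega, by omega, 0, fun k => ?_⟩
        push_cast [Nat.cast_sub h.le]
        simp
    rw [hm, zero_mul]

end
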